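/- Let φ ≥ 0 be a measurable function on (0,1)^d such that for some constant c > 0, the Lebesgue measure of {ξ ∈ (0,1)^d : φ(ξ) ≥ s} is at most c/s for all s > 0. If 1 < p < r < p' < ∞ (where 1/p + 1/p' = 1), then there is a constant C_p > 0 such that for all f ∈ ℓ^p(ℤ^d): (∫_{(0,1)^d} |F(f)(ξ)|^r φ(ξ)^{1 − r/p'} dξ)^{1/r} ≤ C_p ‖f‖_{ℓ^p}. -/

import Mathlib

open MeasureTheory Real Complex

/-- The open unit cube `(0,1)^d` in `ℝ^d`. -/
noncomputable def unitCube (d : ℕ) : Set (Fin d → ℝ) :=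
  Set.univ.pi fun _ => Set.Ioo (0 : ℝ) 1

/-- Discrete Fourier transform on `ℤ^d`: `F(f)(ξ) = ∑_{n ∈ ℤ^d} f(n) e^{2πi n·ξ}`. -/
noncomputable def dft (d : ℕ) (f : (Fin d → ℤ) → ℂ) (ξ : Fin d → ℝ) : ℂ :=
  ∑' n : Fin d → ℤ, f n * Complex.exp (2 * Real.pi * Complex.I * ∑ i, (n i : ℂ) * (ξ i : ℂ))


open Set ENNReal

/-- The character `ξ ↦ e^{2πi n·ξ}`. -/
noncomputable def latticeChar (d : ℕ) (n : Fin d → ℤ) (ξ : Fin d → ℝ) : ℂ :=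
  Complex.exp (2 * Real.pi * Complex.I * ∑ i, (n i : ℂ) * (ξ i : ℂ))

lemma latticeChar_eq_prod (d : ℕ) (n : Fin d → ℤ) (ξ : Fin d → ℝ) :
    latticeChar d n ξ = ∏ i, Complex.exp (2 * Real.pi * Complex.I * n i * ξ i) := by
  rw [latticeChar, Finset.mul_sum, Complex.exp_sum]
  simp only [mul_assoc]

lemma norm_latticeChar (d : ℕ) (n : Fin d → ℤ) (ξ : Fin d → ℝ) : ‖latticeChar d n ξ‖ = 1 := by
  have h : 2 * Real.pi * Complex.I * ∑ i, (n i : ℂ) * (ξ i : ℂ) =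
      ((2 * Real.pi * ∑ i, (n i : ℝ) * ξ i : ℝ) : ℂ) * Complex.I := by
    push_cast; ring
  rw [latticeChar, h, Complex.norm_exp_ofReal_mul_I]

lemma continuous_latticeChar (d : ℕ) (n : Fin d → ℤ) : Continuous (latticeChar d n) := by
  unfold latticeChar
  fun_prop

lemma conj_latticeChar (d : ℕ) (n : Fin d → ℤ) (ξ : Fin d → ℝ) :
    (starRingEnd ℂ) (latticeChar d n ξ) = latticeChar d (-n) ξ := by
  simp only [latticeChar, ← Complex.exp_conj, map_mul, map_sum, Complex.conj_I, Complex.conj_ofReal,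
    map_ofNat, map_intCast]
  simp

lemma latticeChar_mul (d : ℕ) (m n : Fin d → ℤ) (ξ : Fin d → ℝ) :
    latticeChar d m ξ * latticeChar d n ξ = latticeChar d (m + n) ξ := by
  simp only [latticeChar, ← Complex.exp_add, ← mul_add, ← Finset.sum_add_distrib]
  simp [add_mul]

lemma volume_restrict_unitCube (d : ℕ) :
    (volume : Measure (Fin d → ℝ)).restrict (unitCube d) =
      Measure.pi fun _ => (volume : Measure ℝ).restrict (Ioo 0 1) := by
  rw [unitCube, volume_pi, Measure.restrict_pi_pi]

instance isProbabilityMeasure_restrict_unitCube (d : ℕ) :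
    IsProbabilityMeasure ((volume : Measure (Fin d → ℝ)).restrict (unitCube d)) := by
  have : IsProbabilityMeasure ((volume : Measure ℝ).restrict (Ioo 0 1)) := ⟨by simp⟩
  rw [volume_restrict_unitCube]
  infer_instance

lemma setIntegral_exp_int_mul {k : ℤ} (hk : k ≠ 0) :
    ∫ x in Ioo (0 : ℝ) 1, Complex.exp (2 * Real.pi * Complex.I * k * x) = 0 := by
  have h0 : 2 * Real.pi * Complex.I * k ≠ 0 := by simp [hk, Real.pi_ne_zero]
  rw [← integral_Ioc_eq_integral_Ioo, ← intervalIntegral.integral_of_le zero_le_one,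
    integral_exp_mul_complex h0]
  have : Complex.exp (2 * Real.pi * Complex.I * k) = 1 := by
    rw [mul_comm]; exact Complex.exp_int_mul_two_pi_mul_I k
  simp [this]

lemma integral_latticeChar (d : ℕ) (n : Fin d → ℤ) :
    ∫ ξ in unitCube d, latticeChar d n ξ = if n = 0 then 1 else 0 := by
  split_ifs with h
  · simp [h, latticeChar]
  · obtain ⟨i, hi⟩ := Function.ne_iff.mp h
    rw [volume_restrict_unitCube]
    simp only [latticeChar_eq_prod]
    rw [integral_fintype_prod_eq_prod (fun i (x : ℝ) =>
      Complex.exp (2 * Real.pi * Complex.I * n i * x))]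
    exact Finset.prod_eq_zero (Finset.mem_univ i) (setIntegral_exp_int_mul hi)

lemma summable_norm_mul_latticeChar {d : ℕ} {f : (Fin d → ℤ) → ℂ}
    (hf : Summable fun n => ‖f n‖) (ξ : Fin d → ℝ) :
    Summable fun n => ‖f n * latticeChar d n ξ‖ := by
  simpa [norm_latticeChar] using hf

lemma dft_eq_tsum (d : ℕ) (f : (Fin d → ℤ) → ℂ) (ξ : Fin d → ℝ) :
    dft d f ξ = ∑' n, f n * latticeChar d n ξ := rfl

lemma continuous_dft {d : ℕ} {f : (Fin d → ℤ) → ℂ} (hf : Summable fun n => ‖f n‖) :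
    Continuous (dft d f) :=
  continuous_tsum (fun n => continuous_const.mul (continuous_latticeChar d n)) hf
    fun n ξ => by rw [norm_mul, ← latticeChar, norm_latticeChar, mul_one]

lemma norm_dft_le {d : ℕ} {f : (Fin d → ℤ) → ℂ} (hf : Summable fun n => ‖f n‖)
    (ξ : Fin d → ℝ) : ‖dft d f ξ‖ ≤ ∑' n, ‖f n‖ := by
  refine (norm_tsum_le_tsum_norm (summable_norm_mul_latticeChar hf ξ)).trans_eq ?_
  simp only [norm_mul, norm_latticeChar, mul_one]

lemma summable_norm_indicator {ι E : Type*} [SeminormedAddCommGroup E] {f : ι → E}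
    (hf : Summable fun n => ‖f n‖) (A : Set ι) :
    Summable fun n => ‖A.indicator f n‖ :=
  hf.of_nonneg_of_le (fun _ => norm_nonneg _) fun n => norm_indicator_le_norm_self f n

lemma norm_dft_le_add_compl {d : ℕ} {f : (Fin d → ℤ) → ℂ} (hf : Summable fun n => ‖f n‖)
    (A : Set (Fin d → ℤ)) (ξ : Fin d → ℝ) :
    ‖dft d f ξ‖ ≤ ‖dft d (A.indicator f) ξ‖ + ∑' n, ‖Aᶜ.indicator f n‖ := by
  have h1 := summable_norm_indicator hf A
  have h2 := summable_norm_indicator hf Aᶜ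
  have : dft d f ξ = dft d (A.indicator f) ξ + dft d (Aᶜ.indicator f) ξ := by
    simp only [dft_eq_tsum]
    rw [← (summable_norm_mul_latticeChar h1 ξ).of_norm.tsum_add
      (summable_norm_mul_latticeChar h2 ξ).of_norm]
    refine tsum_congr fun n => ?_
    rw [← add_mul, indicator_self_add_compl_apply]
  rw [this]
  exact (norm_add_le _ _).trans (by gcongr; exact norm_dft_le h2 ξ)

lemma integrable_of_bounded_unitCube {d : ℕ} {g : (Fin d → ℝ) → ℂ} (hg : Continuous g) {C : ℝ}
    (hC : ∀ ξ, ‖g ξ‖ ≤ C) : Integrable g (volume.restrict (unitCube d)) :=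
  Integrable.of_bound hg.aestronglyMeasurable C (ae_of_all _ hC)

lemma integral_dft_mul_latticeChar {d : ℕ} {f : (Fin d → ℤ) → ℂ}
    (hf : Summable fun n => ‖f n‖) (k : Fin d → ℤ) :
    ∫ ξ in unitCube d, dft d f ξ * latticeChar d (-k) ξ = f k := by
  have h : ∀ ξ, dft d f ξ * latticeChar d (-k) ξ = ∑' n, f n * latticeChar d (n - k) ξ := by
    intro ξ
    rw [dft_eq_tsum, ← tsum_mul_right]
    simp only [mul_assoc, latticeChar_mul, sub_eq_add_neg]
  simp only [h]
  rw [← integral_tsum_of_summable_integral_norm]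
  · simp only [integral_const_mul, integral_latticeChar, sub_eq_zero]
    rw [tsum_eq_single k (by intro b hb; simp [hb])]
    simp
  · intro n
    exact integrable_of_bounded_unitCube (continuous_const.mul (continuous_latticeChar d _))
      (C := ‖f n‖) fun ξ => by simp [norm_latticeChar]
  · simpa [norm_latticeChar] using hf

lemma integral_norm_dft_sq {d : ℕ} {f : (Fin d → ℤ) → ℂ} (hf : Summable fun n => ‖f n‖) :
    ((∫ ξ in unitCube d, ‖dft d f ξ‖ ^ 2 : ℝ) : ℂ) = ∑' n, ((‖f n‖ ^ 2 : ℝ) : ℂ) := by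
  have h : ∀ ξ, ((‖dft d f ξ‖ ^ 2 : ℝ) : ℂ) =
      ∑' n, (starRingEnd ℂ) (f n) * (dft d f ξ * latticeChar d (-n) ξ) := by
    intro ξ
    push_cast
    rw [← Complex.mul_conj']
    conv_lhs => rw [dft_eq_tsum d f ξ, Complex.conj_tsum, ← dft_eq_tsum, ← tsum_mul_left]
    refine tsum_congr fun n => ?_
    rw [map_mul, conj_latticeChar]
    ring
  rw [← integral_complex_ofReal]
  simp only [h]
  rw [← integral_tsum_of_summable_integral_norm]
  · refine tsum_congr fun n => ?_
    rw [integral_const_mul, integral_dft_mul_latticeChar hf, Complex.conj_mul']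
    push_cast; rfl
  · intro n
    refine integrable_of_bounded_unitCube (continuous_const.mul
      ((continuous_dft hf).mul (continuous_latticeChar d _)))
      (C := ‖f n‖ * ∑' n, ‖f n‖) fun ξ => ?_
    simp only [norm_mul, norm_latticeChar, mul_one, RCLike.norm_conj]
    gcongr
    exact norm_dft_le hf ξ
  · simp only [norm_mul, norm_latticeChar, mul_one, RCLike.norm_conj, integral_const_mul]
    exact hf.mul_right _

lemma summable_norm_sq {ι : Type*} {f : ι → ℂ} (hf : Summable fun n => ‖f n‖) :
    Summable fun n => ‖f n‖ ^ 2 := by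
  refine (hf.mul_left (∑' n, ‖f n‖)).of_nonneg_of_le (fun n => by positivity) fun n => ?_
  rw [sq]
  gcongr
  exact hf.le_tsum n fun _ _ => norm_nonneg _

lemma lintegral_norm_dft_sq {d : ℕ} {f : (Fin d → ℤ) → ℂ} (hf : Summable fun n => ‖f n‖) :
    ∫⁻ ξ in unitCube d, ENNReal.ofReal (‖dft d f ξ‖ ^ 2) =
      ∑' n, ENNReal.ofReal (‖f n‖ ^ 2) := by
  have h := integral_norm_dft_sq hf
  rw [← Complex.ofReal_tsum, Complex.ofReal_inj] at h
  rw [← ofReal_integral_eq_lintegral_ofReal, h,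
    ENNReal.ofReal_tsum_of_nonneg (fun n => by positivity) (summable_norm_sq hf)]
  · refine Integrable.of_bound ((continuous_dft hf).norm.pow 2).aestronglyMeasurable
      ((∑' n, ‖f n‖) ^ 2) (ae_of_all _ fun ξ => ?_)
    rw [norm_pow, norm_norm]
    gcongr
    exact norm_dft_le hf ξ
  · exact ae_of_all _ fun ξ => by positivity

lemma lintegral_norm_dft_indicator_sq {d : ℕ} {f : (Fin d → ℤ) → ℂ}
    (hf : Summable fun n => ‖f n‖) (A : Set (Fin d → ℤ)) :
    ∫⁻ ξ in unitCube d, ENNReal.ofReal (‖dft d (A.indicator f) ξ‖ ^ 2) =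
      ∑' n, A.indicator (fun n => ENNReal.ofReal (‖f n‖ ^ 2)) n := by
  rw [lintegral_norm_dft_sq (summable_norm_indicator hf A)]
  refine tsum_congr fun n => ?_
  by_cases hn : n ∈ A <;> simp [hn]

lemma lintegral_Ioc_rpow {a b : ℝ} (ha : -1 < a) (hb : 0 ≤ b) :
    ∫⁻ t in Ioc 0 b, ENNReal.ofReal (t ^ a) = ENNReal.ofReal (b ^ (a + 1) / (a + 1)) := by
  rw [← ofReal_integral_eq_lintegral_ofReal, ← intervalIntegral.integral_of_le hb,
    integral_rpow (Or.inl ha), Real.zero_rpow (by linarith), sub_zero]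
  · exact (intervalIntegrable_iff_integrableOn_Ioc_of_le hb).1
      (intervalIntegral.intervalIntegrable_rpow' ha)
  · exact (ae_restrict_iff' measurableSet_Ioc).2 (ae_of_all _ fun t ht => Real.rpow_nonneg ht.1.le _)

lemma lintegral_Ioi_rpow {a b : ℝ} (ha : a < -1) (hb : 0 < b) :
    ∫⁻ t in Ioi b, ENNReal.ofReal (t ^ a) = ENNReal.ofReal (-b ^ (a + 1) / (a + 1)) := by
  rw [← ofReal_integral_eq_lintegral_ofReal, integral_Ioi_rpow_of_lt ha hb]
  · exact integrableOn_Ioi_rpow_of_lt ha hb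
  · exact (ae_restrict_iff' measurableSet_Ioi).2
      (ae_of_all _ fun t ht => Real.rpow_nonneg (hb.trans ht).le _)

lemma measure_lt_le_lintegral_sq {α : Type*} [MeasurableSpace α] (μ : Measure α) {g : α → ℝ}
    (hg : Measurable g) {t : ℝ} (ht : 0 < t) :
    μ {x | t < g x} ≤ ENNReal.ofReal (1 / t ^ 2) * ∫⁻ x, ENNReal.ofReal (g x ^ 2) ∂μ := by
  have h0 : ENNReal.ofReal (t ^ 2) ≠ 0 := (ENNReal.ofReal_pos.2 (by positivity)).ne'
  calc μ {x | t < g x} ≤ μ {x | ENNReal.ofReal (t ^ 2) ≤ ENNReal.ofReal (g x ^ 2)} := by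
        refine measure_mono fun x (hx : t < g x) => ENNReal.ofReal_le_ofReal ?_
        gcongr
    _ ≤ (∫⁻ x, ENNReal.ofReal (g x ^ 2) ∂μ) / ENNReal.ofReal (t ^ 2) :=
        meas_ge_le_lintegral_div (by fun_prop) h0 ENNReal.ofReal_ne_top
    _ = _ := by
        rw [ENNReal.div_eq_inv_mul, one_div, ENNReal.ofReal_inv_of_pos (by positivity)]

lemma lintegral_Ioi_zero_indicator_le {B : Set ℝ} (hB : MeasurableSet B) (g : ℝ → ℝ≥0∞) :
    ∫⁻ t in Ioi 0, B.indicator g t ≤ ∫⁻ t in B, g t :=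
  (setLIntegral_le_lintegral _ _).trans_eq (lintegral_indicator hB _)

/-- The Hausdorff–Young inequality for `dft`, with a non-optimal constant. -/
lemma hausdorff_young_dft (d : ℕ) {p q : ℝ} (hp : 1 < p) (hq : 2 < q)
    (hpq : (p - 1) * (q - 1) = 1) :
    ∃ C : ℝ, 0 ≤ C ∧ ∀ f : (Fin d → ℤ) → ℂ, Summable (fun n => ‖f n‖) →
      Summable (fun n => ‖f n‖ ^ p) →
      ∫⁻ ξ in unitCube d, ENNReal.ofReal (‖dft d f ξ‖ ^ q) ≤
        ENNReal.ofReal (C * (∑' n, ‖f n‖ ^ p) ^ (q - 1)) := by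
  refine ⟨q * (4 * 2 ^ (q - 2) / (q - 2)),
    mul_nonneg (by linarith) (div_nonneg (by positivity) (by linarith)), fun f hf hfp => ?_⟩
  set S := ∑' n, ‖f n‖ ^ p with hS
  have hS0 : 0 ≤ S := tsum_nonneg fun n => by positivity
  obtain hS' | hS' := hS0.eq_or_lt
  · have hf0 : ∀ n, f n = 0 := fun n => by
      have := hfp.le_tsum n fun _ _ => by positivity
      rw [← hS, ← hS'] at this
      simpa using (Real.rpow_eq_zero (norm_nonneg _) (by linarith)).1
        (this.antisymm (by positivity))
    simp [dft_eq_tsum, hf0, Real.zero_rpow (by linarith : q ≠ 0)]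
  set A : ℝ → Set (Fin d → ℤ) := fun t => {n | t ≤ 2 * S / ‖f n‖ ^ (p - 1)} with hA
  have hcompl : ∀ t, 0 < t → ∑' n, ‖(A t)ᶜ.indicator f n‖ ≤ t / 2 := by
    intro t ht
    have h1 : ∀ n, ‖(A t)ᶜ.indicator f n‖ ≤ t / (2 * S) * ‖f n‖ ^ p := by
      intro n
      by_cases hn : n ∈ A t
      · simp only [mem_compl_iff, hn, not_true_eq_false, not_false_eq_true, indicator_of_notMem,
          norm_zero]
        positivity
      · rw [indicator_of_mem hn]
        obtain h0 | h0 := (norm_nonneg (f n)).eq_or_lt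
        · rw [← h0, Real.zero_rpow (by linarith), mul_zero]
        · have h2 : 2 * S < t * ‖f n‖ ^ (p - 1) := by
            rw [← div_lt_iff₀ (by positivity)]
            simpa [hA] using hn
          have h3 : ‖f n‖ ^ p = ‖f n‖ ^ (p - 1) * ‖f n‖ := by
            rw [← Real.rpow_add_one h0.ne', sub_add_cancel]
          rw [h3, div_mul_eq_mul_div, le_div_iff₀ (by positivity)]
          nlinarith
    calc ∑' n, ‖(A t)ᶜ.indicator f n‖ ≤ ∑' n, t / (2 * S) * ‖f n‖ ^ p :=
          (summable_norm_indicator hf _).tsum_le_tsum h1 (hfp.mul_left _)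
      _ = t / 2 := by rw [tsum_mul_left, ← hS]; field_simp
  have hmeas := (continuous_dft hf).norm.measurable
  rw [lintegral_rpow_eq_lintegral_meas_lt_mul _ (ae_of_all _ fun _ => norm_nonneg _)
    hmeas.aemeasurable (by linarith)]
  have hpt : ∀ t ∈ Ioi (0 : ℝ),
      (volume.restrict (unitCube d)) {ξ | t < ‖dft d f ξ‖} * ENNReal.ofReal (t ^ (q - 1)) ≤
      ∑' n, (Ioc 0 (2 * S / ‖f n‖ ^ (p - 1))).indicator
        (fun t => ENNReal.ofReal (4 * ‖f n‖ ^ 2) * ENNReal.ofReal (t ^ (q - 3))) t := by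
    intro t (ht : 0 < t)
    have h1 : (volume.restrict (unitCube d)) {ξ | t < ‖dft d f ξ‖} ≤
        ENNReal.ofReal (1 / (t / 2) ^ 2) *
          ∑' n, (A t).indicator (fun n => ENNReal.ofReal (‖f n‖ ^ 2)) n := by
      rw [← lintegral_norm_dft_indicator_sq hf]
      refine le_trans (measure_mono fun ξ (hξ : t < ‖dft d f ξ‖) => ?_)
        (measure_lt_le_lintegral_sq _
          (continuous_dft (summable_norm_indicator hf _)).norm.measurable (half_pos ht))
      have := norm_dft_le_add_compl hf (A t) ξ
      have := hcompl t ht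
      show t / 2 < _
      linarith
    refine (mul_le_mul_left h1 _).trans_eq ?_
    rw [mul_right_comm, ← ENNReal.tsum_mul_left]
    refine tsum_congr fun n => ?_
    have h3 : t ^ (q - 1) = t ^ (q - 3) * t ^ 2 := by
      rw [← Real.rpow_natCast, ← Real.rpow_add ht]; norm_num; ring_nf
    by_cases hn : n ∈ A t
    · have hn' : t ∈ Ioc 0 (2 * S / ‖f n‖ ^ (p - 1)) := ⟨ht, hn⟩
      rw [indicator_of_mem hn, indicator_of_mem hn', ← ENNReal.ofReal_mul (by positivity),
        ← ENNReal.ofReal_mul (by positivity), ← ENNReal.ofReal_mul (by positivity), h3]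
      congr 1
      field_simp
      ring
    · have hn' : t ∉ Ioc 0 (2 * S / ‖f n‖ ^ (p - 1)) := fun h => hn h.2
      rw [indicator_of_notMem hn, indicator_of_notMem hn', mul_zero]
  have hterm : ∀ n, ∫⁻ t in Ioi 0, (Ioc 0 (2 * S / ‖f n‖ ^ (p - 1))).indicator
        (fun t => ENNReal.ofReal (4 * ‖f n‖ ^ 2) * ENNReal.ofReal (t ^ (q - 3))) t ≤
      ENNReal.ofReal (4 * 2 ^ (q - 2) / (q - 2) * S ^ (q - 2) * ‖f n‖ ^ p) := by
    intro n
    refine (lintegral_Ioi_zero_indicator_le measurableSet_Ioc _).trans ?_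
    rw [lintegral_const_mul' _ _ ENNReal.ofReal_ne_top,
      lintegral_Ioc_rpow (by linarith) (by positivity), ← ENNReal.ofReal_mul (by positivity)]
    refine ENNReal.ofReal_le_ofReal ?_
    obtain h0 | h0 := (norm_nonneg (f n)).eq_or_lt
    · simp [← h0, Real.zero_rpow (by linarith : p ≠ 0)]
    · have h3 : ‖f n‖ ^ p * (‖f n‖ ^ (p - 1)) ^ (q - 2) = ‖f n‖ ^ 2 := by
        rw [← Real.rpow_mul h0.le, ← Real.rpow_add h0, ← Real.rpow_natCast]
        congr 1
        push_cast
        linarith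
      have h4 : q - 3 + 1 = q - 2 := by ring
      have h5 : q - 2 ≠ 0 := by linarith
      rw [h4, Real.div_rpow (by positivity) (by positivity), Real.mul_rpow (by norm_num) hS0, ← h3]
      apply le_of_eq
      field_simp
  calc _ ≤ ENNReal.ofReal q * ∫⁻ t in Ioi 0, ∑' n,
          (Ioc 0 (2 * S / ‖f n‖ ^ (p - 1))).indicator
          (fun t => ENNReal.ofReal (4 * ‖f n‖ ^ 2) * ENNReal.ofReal (t ^ (q - 3))) t := by
        exact mul_le_mul' le_rfl (setLIntegral_mono' measurableSet_Ioi hpt)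
    _ ≤ ENNReal.ofReal q *
        ∑' n, ENNReal.ofReal (4 * 2 ^ (q - 2) / (q - 2) * S ^ (q - 2) * ‖f n‖ ^ p) := by
        rw [lintegral_tsum fun n => ?_]
        · gcongr with n
          exact hterm n
        · exact (Measurable.indicator (by fun_prop) measurableSet_Ioc).aemeasurable
    _ = _ := by
        have h5 : 0 ≤ 4 * 2 ^ (q - 2) / (q - 2) := div_nonneg (by positivity) (by linarith)
        rw [← ENNReal.ofReal_tsum_of_nonneg (fun n => by positivity) (hfp.mul_left _),
          ← ENNReal.ofReal_mul (by linarith), tsum_mul_left, ← hS]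
        congr 1
        have : S ^ (q - 1) = S ^ (q - 2) * S := by
          rw [← Real.rpow_add_one hS'.ne']; ring_nf
        rw [this]
        ring

/-- The measure `φ² dξ` on the unit cube. -/
noncomputable def sqWeightMeasure (d : ℕ) (φ : (Fin d → ℝ) → ℝ) : Measure (Fin d → ℝ) :=
  (volume.restrict (unitCube d)).withDensity fun ξ => ENNReal.ofReal (φ ξ ^ 2)

lemma lintegral_sqWeightMeasure {d : ℕ} {φ : (Fin d → ℝ) → ℝ} (hφ : Measurable φ)
    {g : (Fin d → ℝ) → ℝ≥0∞} (hg : Measurable g) :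
    ∫⁻ ξ, g ξ ∂sqWeightMeasure d φ = ∫⁻ ξ in unitCube d, ENNReal.ofReal (φ ξ ^ 2) * g ξ :=
  lintegral_withDensity_eq_lintegral_mul _ (by fun_prop) hg

lemma sqWeightMeasure_lt_le {d : ℕ} {φ : (Fin d → ℝ) → ℝ} (hφ : Measurable φ)
    (hφ0 : ∀ ξ, 0 ≤ φ ξ) {c : ℝ} (hc : 0 < c)
    (hdist : ∀ s : ℝ, 0 < s → volume {ξ ∈ unitCube d | s ≤ φ ξ} ≤ ENNReal.ofReal (c / s))
    {s : ℝ} (hs : 0 ≤ s) :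
    sqWeightMeasure d φ {ξ | φ ξ < s} ≤ ENNReal.ofReal (2 * c * s) := by
  have hB : MeasurableSet {ξ | φ ξ < s} := measurableSet_lt hφ measurable_const
  have hind0 : ∀ ξ, 0 ≤ {ξ | φ ξ < s}.indicator φ ξ := fun ξ =>
    indicator_nonneg (fun ξ _ => hφ0 ξ) ξ
  rw [sqWeightMeasure, withDensity_apply _ hB, ← lintegral_indicator hB]
  have h1 : ∀ ξ, {ξ | φ ξ < s}.indicator (fun ξ => ENNReal.ofReal (φ ξ ^ 2)) ξ =
      ENNReal.ofReal ({ξ | φ ξ < s}.indicator φ ξ ^ (2 : ℝ)) := by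
    intro ξ
    by_cases h : ξ ∈ {ξ | φ ξ < s} <;> simp [h]
  simp only [h1]
  rw [lintegral_rpow_eq_lintegral_meas_le_mul _ (ae_of_all _ hind0)
    (hφ.indicator hB).aemeasurable (by norm_num)]
  have h2 : ∀ t ∈ Ioi (0 : ℝ), (volume.restrict (unitCube d))
      {ξ | t ≤ {ξ | φ ξ < s}.indicator φ ξ} * ENNReal.ofReal (t ^ ((2 : ℝ) - 1)) ≤
      (Ioc 0 s).indicator (fun _ => ENNReal.ofReal c) t := by
    intro t (ht : 0 < t)
    by_cases hts : t ≤ s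
    · rw [indicator_of_mem (show t ∈ Ioc 0 s from ⟨ht, hts⟩)]
      have h3 : (volume.restrict (unitCube d)) {ξ | t ≤ {ξ | φ ξ < s}.indicator φ ξ} ≤
          ENNReal.ofReal (c / t) := by
        refine le_trans ?_ (hdist t ht)
        rw [Measure.restrict_apply (measurableSet_le measurable_const (hφ.indicator hB))]
        refine measure_mono fun ξ hξ => ⟨hξ.2, hξ.1.trans ?_⟩
        exact indicator_le_self' (fun ξ _ => hφ0 ξ) ξ
      refine (mul_le_mul_left h3 _).trans_eq ?_
      rw [← ENNReal.ofReal_mul (by positivity)]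
      norm_num
      field_simp
    · have h3 : {ξ | t ≤ {ξ | φ ξ < s}.indicator φ ξ} = ∅ := by
        refine eq_empty_of_forall_notMem fun ξ (hξ : t ≤ _) => hts (hξ.trans ?_)
        by_cases h : ξ ∈ {ξ | φ ξ < s}
        · rw [indicator_of_mem h]; exact le_of_lt h
        · rw [indicator_of_notMem h]; exact hs
      simp [h3]
  refine (mul_le_mul' le_rfl ((setLIntegral_mono' measurableSet_Ioi h2).trans
    (lintegral_Ioi_zero_indicator_le measurableSet_Ioc _))).trans_eq ?_
  rw [setLIntegral_const, Real.volume_Ioc, sub_zero, ← ENNReal.ofReal_mul hc.le,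
    ← ENNReal.ofReal_mul (by norm_num), mul_assoc]

/-- Paley's inequality for `dft`. -/
lemma paley_dft {d : ℕ} {φ : (Fin d → ℝ) → ℝ} (hφ : Measurable φ)
    (hφ0 : ∀ ξ, 0 ≤ φ ξ) {c : ℝ} (hc : 0 < c)
    (hdist : ∀ s : ℝ, 0 < s → volume {ξ ∈ unitCube d | s ≤ φ ξ} ≤ ENNReal.ofReal (c / s))
    {p : ℝ} (hp : 1 < p) (hp2 : p < 2) :
    ∃ C : ℝ, 0 ≤ C ∧ ∀ f : (Fin d → ℤ) → ℂ, Summable (fun n => ‖f n‖) →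
      Summable (fun n => ‖f n‖ ^ p) →
      ∫⁻ ξ in unitCube d, ENNReal.ofReal (‖dft d f ξ‖ ^ p * φ ξ ^ (2 - p)) ≤
        ENNReal.ofReal (C * ∑' n, ‖f n‖ ^ p) := by
  have hC : 0 ≤ 4 / (2 - p) + 4 * c / (p - 1) :=
    add_nonneg (div_nonneg (by norm_num) (by linarith)) (div_nonneg (by positivity) (by linarith))
  refine ⟨p * (4 / (2 - p) + 4 * c / (p - 1)), mul_nonneg (by linarith) hC, fun f hf hfp => ?_⟩
  have hmeas : ∀ {g : (Fin d → ℤ) → ℂ}, Summable (fun n => ‖g n‖) →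
      Measurable fun ξ => ‖dft d g ξ‖ / φ ξ := fun hg =>
    (continuous_dft hg).norm.measurable.div hφ
  have hweight : ∫⁻ ξ in unitCube d, ENNReal.ofReal (‖dft d f ξ‖ ^ p * φ ξ ^ (2 - p)) =
      ∫⁻ ξ, ENNReal.ofReal ((‖dft d f ξ‖ / φ ξ) ^ p) ∂sqWeightMeasure d φ := by
    rw [lintegral_sqWeightMeasure hφ ((hmeas hf).pow_const p).ennreal_ofReal]
    refine lintegral_congr fun ξ => ?_
    rw [← ENNReal.ofReal_mul (by positivity)]
    congr 1
    obtain h0 | h0 := (hφ0 ξ).eq_or_lt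
    · simp [← h0, Real.zero_rpow (by linarith : 2 - p ≠ 0)]
    · rw [Real.div_rpow (norm_nonneg _) h0.le, Real.rpow_sub h0, Real.rpow_ofNat]
      field_simp
  rw [hweight, lintegral_rpow_eq_lintegral_meas_lt_mul _
    (ae_of_all _ fun ξ => div_nonneg (norm_nonneg _) (hφ0 ξ)) (hmeas hf).aemeasurable (by linarith)]
  set A : ℝ → Set (Fin d → ℤ) := fun t => {n | ‖f n‖ < t}
  set G : (Fin d → ℤ) → ℝ → ℝ≥0∞ := fun n => (Ioi ‖f n‖).indicator
    (fun t => ENNReal.ofReal (4 * ‖f n‖ ^ 2) * ENNReal.ofReal (t ^ (p - 3))) with hG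
  set H : (Fin d → ℤ) → ℝ → ℝ≥0∞ := fun n => (Ioc 0 ‖f n‖).indicator
    (fun t => ENNReal.ofReal (4 * c * ‖f n‖) * ENNReal.ofReal (t ^ (p - 2))) with hH
  have hpt : ∀ t ∈ Ioi (0 : ℝ),
      sqWeightMeasure d φ {ξ | t < ‖dft d f ξ‖ / φ ξ} * ENNReal.ofReal (t ^ (p - 1)) ≤
      ∑' n, (G n t + H n t) := by
    intro t (ht : 0 < t)
    set T := ∑' n, ‖(A t)ᶜ.indicator f n‖ with hT
    have hT0 : 0 ≤ T := tsum_nonneg fun n => norm_nonneg _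
    have hfA := summable_norm_indicator hf (A t)
    have hsub : {ξ | t < ‖dft d f ξ‖ / φ ξ} ⊆
        {ξ | t / 2 < ‖dft d ((A t).indicator f) ξ‖ / φ ξ} ∪ {ξ | φ ξ < 2 * T / t} := by
      intro ξ (hξ : t < _)
      have h0 : 0 < φ ξ := by
        refine (hφ0 ξ).lt_of_ne fun h => ?_
        rw [← h, _root_.div_zero] at hξ
        linarith
      rw [lt_div_iff₀ h0] at hξ
      have h1 := norm_dft_le_add_compl hf (A t) ξ
      by_contra! hcon
      simp only [mem_union, mem_ofPred_eq, not_or, not_lt] at hcon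
      rw [div_le_iff₀ h0, div_le_iff₀ ht] at hcon
      linarith [hcon.1, hcon.2]
    have hsmall : sqWeightMeasure d φ {ξ | t / 2 < ‖dft d ((A t).indicator f) ξ‖ / φ ξ} ≤
        ENNReal.ofReal (1 / (t / 2) ^ 2) *
          ∑' n, (A t).indicator (fun n => ENNReal.ofReal (‖f n‖ ^ 2)) n := by
      refine (measure_lt_le_lintegral_sq _ (hmeas hfA) (half_pos ht)).trans
        (mul_le_mul' le_rfl ?_)
      rw [lintegral_sqWeightMeasure hφ ((hmeas hfA).pow_const 2).ennreal_ofReal,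
        ← lintegral_norm_dft_indicator_sq hf]
      refine lintegral_mono fun ξ => ?_
      rw [← ENNReal.ofReal_mul (by positivity)]
      refine ENNReal.ofReal_le_ofReal ?_
      obtain h0 | h0 := (hφ0 ξ).eq_or_lt
      · rw [← h0]; simp
      · apply le_of_eq; field_simp
    have hlarge : sqWeightMeasure d φ {ξ | φ ξ < 2 * T / t} ≤
        ENNReal.ofReal (4 * c / t) *
          ∑' n, (A t)ᶜ.indicator (fun n => ENNReal.ofReal ‖f n‖) n := by
      refine (sqWeightMeasure_lt_le hφ hφ0 hc hdist (by positivity)).trans_eq ?_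
      have h1 : ∀ n, (A t)ᶜ.indicator (fun n => ENNReal.ofReal ‖f n‖) n =
          ENNReal.ofReal ‖(A t)ᶜ.indicator f n‖ := by
        intro n
        by_cases hn : n ∈ A t <;> simp [hn]
      simp only [h1]
      rw [← ENNReal.ofReal_tsum_of_nonneg (fun n => norm_nonneg _) (summable_norm_indicator hf _),
        ← hT, ← ENNReal.ofReal_mul (by positivity)]
      congr 1
      ring
    refine (mul_le_mul_left ((measure_mono hsub).trans ((measure_union_le _ _).trans
      (add_le_add hsmall hlarge))) _).trans_eq ?_
    rw [← ENNReal.tsum_mul_left, ← ENNReal.tsum_mul_left, ← ENNReal.tsum_add,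
      ← ENNReal.tsum_mul_right]
    refine tsum_congr fun n => ?_
    by_cases hn : ‖f n‖ < t
    · have h1 : n ∈ A t := hn
      have h2 : n ∉ (A t)ᶜ := fun h => h hn
      have h3 : t ∉ Ioc 0 ‖f n‖ := fun h => hn.not_ge h.2
      have h4 : t ^ (p - 1) = t ^ (p - 3) * t ^ 2 := by
        rw [← Real.rpow_natCast, ← Real.rpow_add ht]; norm_num; ring_nf
      simp only [hG, hH]
      rw [indicator_of_mem h1, indicator_of_notMem h2, indicator_of_notMem h3,
        indicator_of_mem (show t ∈ Ioi ‖f n‖ from hn), mul_zero, add_zero, add_zero,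
        ← ENNReal.ofReal_mul (by positivity), ← ENNReal.ofReal_mul (by positivity),
        ← ENNReal.ofReal_mul (by positivity), h4]
      congr 1
      field_simp
      ring
    · have h1 : n ∉ A t := hn
      have h3 : t ∈ Ioc 0 ‖f n‖ := ⟨ht, not_lt.1 hn⟩
      have h4 : t ^ (p - 1) = t ^ (p - 2) * t := by
        rw [← Real.rpow_add_one ht.ne']; ring_nf
      simp only [hG, hH]
      rw [indicator_of_notMem h1, indicator_of_mem (show n ∈ (A t)ᶜ from h1), indicator_of_mem h3,
        indicator_of_notMem (show t ∉ Ioi ‖f n‖ from hn), mul_zero, zero_add, zero_add,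
        ← ENNReal.ofReal_mul (by positivity), ← ENNReal.ofReal_mul (by positivity),
        ← ENNReal.ofReal_mul (by positivity), h4]
      congr 1
      field_simp
  have hGm : ∀ n, Measurable (G n) := fun n =>
    Measurable.indicator (by fun_prop) measurableSet_Ioi
  have hHm : ∀ n, Measurable (H n) := fun n =>
    Measurable.indicator (by fun_prop) measurableSet_Ioc
  have hGle : ∀ n, ∫⁻ t in Ioi 0, G n t ≤ ENNReal.ofReal (4 / (2 - p) * ‖f n‖ ^ p) := by
    intro n
    refine (lintegral_Ioi_zero_indicator_le measurableSet_Ioi _).trans ?_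
    rw [lintegral_const_mul' _ _ ENNReal.ofReal_ne_top]
    obtain h0 | h0 := (norm_nonneg (f n)).eq_or_lt
    · simp [← h0]
    · rw [lintegral_Ioi_rpow (by linarith) h0, ← ENNReal.ofReal_mul (by positivity)]
      refine ENNReal.ofReal_le_ofReal (le_of_eq ?_)
      have h3 : ‖f n‖ ^ p = ‖f n‖ ^ (p - 3 + 1) * ‖f n‖ ^ 2 := by
        rw [← Real.rpow_natCast, ← Real.rpow_add h0]; norm_num; ring_nf
      have h4 : p - 3 + 1 = -(2 - p) := by ring
      have h5 : 2 - p ≠ 0 := by linarith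
      rw [h3, h4, neg_div_neg_eq]
      field_simp
  have hHle : ∀ n, ∫⁻ t in Ioi 0, H n t ≤ ENNReal.ofReal (4 * c / (p - 1) * ‖f n‖ ^ p) := by
    intro n
    refine (lintegral_Ioi_zero_indicator_le measurableSet_Ioc _).trans ?_
    rw [lintegral_const_mul' _ _ ENNReal.ofReal_ne_top,
      lintegral_Ioc_rpow (by linarith) (norm_nonneg _), ← ENNReal.ofReal_mul (by positivity)]
    refine ENNReal.ofReal_le_ofReal (le_of_eq ?_)
    have h4 : p - 2 + 1 = p - 1 := by ring
    have h5 : p - 1 ≠ 0 := by linarith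
    rw [h4]
    obtain h0 | h0 := (norm_nonneg (f n)).eq_or_lt
    · simp [← h0, Real.zero_rpow (by linarith : p ≠ 0)]
    · have h3 : ‖f n‖ ^ p = ‖f n‖ ^ (p - 1) * ‖f n‖ := by
        rw [← Real.rpow_add_one h0.ne', sub_add_cancel]
      rw [h3]
      field_simp
  calc _ ≤ ENNReal.ofReal p * ∫⁻ t in Ioi 0, ∑' n, (G n t + H n t) :=
        mul_le_mul' le_rfl (setLIntegral_mono' measurableSet_Ioi hpt)
    _ ≤ ENNReal.ofReal p *
        ∑' n, ENNReal.ofReal ((4 / (2 - p) + 4 * c / (p - 1)) * ‖f n‖ ^ p) := by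
        refine mul_le_mul' le_rfl ?_
        rw [lintegral_tsum (f := fun n t => G n t + H n t) fun n => ((hGm n).add (hHm n)).aemeasurable]
        refine ENNReal.tsum_le_tsum fun n => ?_
        rw [lintegral_add_left (hGm n), add_mul, ENNReal.ofReal_add]
        · exact add_le_add (hGle n) (hHle n)
        · exact mul_nonneg (div_nonneg (by norm_num) (by linarith)) (by positivity)
        · exact mul_nonneg (div_nonneg (by positivity) (by linarith)) (by positivity)
    _ = _ := by
        rw [← ENNReal.ofReal_tsum_of_nonneg (fun n => by positivity) (hfp.mul_left _),
          ← ENNReal.ofReal_mul (by linarith), tsum_mul_left]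
        congr 1
        ring

/-- If `φ ≥ 0` satisfies `|{ξ ∈ (0,1)^d : φ(ξ) ≥ s}| ≤ c/s` and `1 < p < r < p' < ∞`
with `1/p + 1/p' = 1`, then
`(∫_{(0,1)^d} |F(f)(ξ)|^r φ(ξ)^{1 - r/p'} dξ)^{1/r} ≤ C_p ‖f‖_{ℓ^p}`. -/
theorem stmt_2 (d : ℕ) (φ : (Fin d → ℝ) → ℝ) (hφmeas : Measurable φ)
    (hφ0 : ∀ ξ, 0 ≤ φ ξ) (c : ℝ) (hc : 0 < c)
    (hdist : ∀ s : ℝ, 0 < s →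
      volume {ξ ∈ unitCube d | s ≤ φ ξ} ≤ ENNReal.ofReal (c / s))
    (p p' r : ℝ) (hconj : 1 / p + 1 / p' = 1)
    (hp : 1 < p) (hpr : p < r) (hrp' : r < p') :
    ∃ Cp : ℝ, 0 < Cp ∧ ∀ f : (Fin d → ℤ) → ℂ,
      Summable (fun n => ‖f n‖) → Summable (fun n => ‖f n‖ ^ p) →
      (∫ ξ in unitCube d, ‖dft d f ξ‖ ^ r * φ ξ ^ (1 - r / p')) ^ (1 / r)
        ≤ Cp * (∑' n : Fin d → ℤ, ‖f n‖ ^ p) ^ (1 / p) := by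
  have hp0 : 0 < p := by linarith
  have hp'0 : 0 < p' := by linarith
  have hr0 : 0 < r := by linarith
  have hpp' : 0 < p' - p := by linarith
  have hmul : p + p' = p * p' := by
    field_simp at hconj
    linarith
  have hexp : (p - 1) * (p' - 1) = 1 := by linear_combination -hmul
  have hp2 : p < 2 := by nlinarith
  have hp'2 : 2 < p' := by nlinarith
  obtain ⟨C₁, hC₁, hPaley⟩ := paley_dft hφmeas hφ0 hc hdist hp hp2
  obtain ⟨C₂, hC₂, hHY⟩ := hausdorff_young_dft d hp hp'2 hexp
  set a := (p' - r) / (p' - p) with ha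
  set b := (r - p) / (p' - p) with hb
  have ha0 : 0 ≤ a := div_nonneg (by linarith) hpp'.le
  have hb0 : 0 ≤ b := div_nonneg (by linarith) hpp'.le
  have hab : a + b = 1 := by rw [ha, hb]; field_simp; ring
  have habr : p * a + p' * b = r := by rw [ha, hb]; field_simp; ring
  have haφ : (2 - p) * a = 1 - r / p' := by
    have h : 2 - p = (p' - p) / p' := by
      rw [eq_div_iff hp'0.ne']
      linarith
    rw [h, ha]
    field_simp
  have hrp : a + (p' - 1) * b = r / p := by
    have h : p' - 1 = p' / p := by
      rw [eq_div_iff hp0.ne']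
      linarith
    rw [h, ← habr]
    field_simp
  have hK : 0 ≤ C₁ ^ a * C₂ ^ b := by positivity
  refine ⟨(C₁ ^ a * C₂ ^ b) ^ (1 / r) + 1, by positivity, fun f hf hfp => ?_⟩
  set S := ∑' n, ‖f n‖ ^ p with hS
  have hS0 : 0 ≤ S := tsum_nonneg fun n => by positivity
  have hFmeas : Measurable fun ξ => ‖dft d f ξ‖ := (continuous_dft hf).norm.measurable
  have hsplit : ∀ ξ, ENNReal.ofReal (‖dft d f ξ‖ ^ r * φ ξ ^ (1 - r / p')) =
      ENNReal.ofReal (‖dft d f ξ‖ ^ p * φ ξ ^ (2 - p)) ^ a *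
        ENNReal.ofReal (‖dft d f ξ‖ ^ p') ^ b := by
    intro ξ
    have h0 := hφ0 ξ
    rw [ENNReal.ofReal_rpow_of_nonneg (by positivity) ha0,
      ENNReal.ofReal_rpow_of_nonneg (by positivity) hb0, ← ENNReal.ofReal_mul (by positivity),
      Real.mul_rpow (by positivity) (by positivity), ← Real.rpow_mul (norm_nonneg _),
      ← Real.rpow_mul h0, ← Real.rpow_mul (norm_nonneg _), haφ, mul_right_comm,
      ← Real.rpow_add_of_nonneg (norm_nonneg _) (by positivity) (by positivity), habr]
  have hbound : ∫⁻ ξ in unitCube d, ENNReal.ofReal (‖dft d f ξ‖ ^ r * φ ξ ^ (1 - r / p')) ≤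
      ENNReal.ofReal (C₁ ^ a * C₂ ^ b * S ^ (r / p)) := by
    simp only [hsplit]
    have hm : Measurable fun ξ => ‖dft d f ξ‖ ^ p * φ ξ ^ (2 - p) :=
      (hFmeas.pow_const p).mul (hφmeas.pow_const _)
    refine (ENNReal.lintegral_mul_norm_pow_le hm.ennreal_ofReal.aemeasurable
      (hFmeas.pow_const p').ennreal_ofReal.aemeasurable ha0 hb0 hab).trans ?_
    calc _ ≤ ENNReal.ofReal (C₁ * S) ^ a * ENNReal.ofReal (C₂ * S ^ (p' - 1)) ^ b := by
          gcongr
          · exact hPaley f hf hfp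
          · exact hHY f hf hfp
      _ = _ := by
          rw [ENNReal.ofReal_rpow_of_nonneg (by positivity) ha0,
            ENNReal.ofReal_rpow_of_nonneg (by positivity) hb0,
            ← ENNReal.ofReal_mul (by positivity), Real.mul_rpow hC₁ hS0,
            Real.mul_rpow hC₂ (by positivity), ← Real.rpow_mul hS0, mul_mul_mul_comm,
            ← Real.rpow_add_of_nonneg hS0 ha0 (mul_nonneg (by linarith) hb0), hrp]
  have hint : ∫ ξ in unitCube d, ‖dft d f ξ‖ ^ r * φ ξ ^ (1 - r / p') ≤
      C₁ ^ a * C₂ ^ b * S ^ (r / p) := by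
    rw [integral_eq_lintegral_of_nonneg_ae
      (ae_of_all _ fun ξ => mul_nonneg (by positivity) (Real.rpow_nonneg (hφ0 ξ) _))
      ((hFmeas.pow_const r).mul (hφmeas.pow_const _)).aestronglyMeasurable]
    exact ENNReal.toReal_le_of_le_ofReal (by positivity) hbound
  calc _ ≤ (C₁ ^ a * C₂ ^ b * S ^ (r / p)) ^ (1 / r) := by
        refine Real.rpow_le_rpow (integral_nonneg fun ξ => ?_) hint (by positivity)
        exact mul_nonneg (by positivity) (Real.rpow_nonneg (hφ0 ξ) _)
    _ = (C₁ ^ a * C₂ ^ b) ^ (1 / r) * S ^ (1 / p) := by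
        rw [Real.mul_rpow hK (by positivity), ← Real.rpow_mul hS0]
        congr 2
        field_simp
    _ ≤ _ := by
        gcongr
        linarith
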